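/- arXiv:1709.04567 — 2 statements merged into one kernel-verified Lean document; each statement's English description precedes it below -/
import Mathlib

section
/- There is a continuous function Q : [2^ω]³_{E_2} → 2^ω such that for every E_2-tree map Φ, Q[[range Φ]³_{E_2}] = 2^ω. Moreover, there is a Borel function K : (2^ω)³ → 2^ω such that for every analytic set A ⊆ 2^ω admitting a Borel reduction of E_2 into E_2 ↾ A, K[[A]³_{E_2}] = 2^ω. -/
open Set Function

/-- The equivalence relation `E₂`: `x E₂ y` iff `Σ {1/(k+1) : x k ≠ y k} < ∞`. -/
def E2 (x y : ℕ → Bool) : Prop :=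
  Summable fun k => if x k = y k then (0 : ℝ) else 1 / ((k : ℝ) + 1)

/-- `δ_m^n` on finite binary strings (read via `getD`). -/
noncomputable def dE2L (m n : ℕ) (a b : List Bool) : ℝ :=
  ∑ k ∈ Finset.Ico m n, if a.getD k false = b.getD k false then 0 else 1 / ((k : ℝ) + 1)

/-- The `E₂`-tree conditions for `g : 2^{<ω} → 2^{<ω}` with respect to a strictly increasing
sequence `m` with `m 0 = 0`. -/
structure IsE2System (m : ℕ → ℕ) (g : List Bool → List Bool) : Prop where
  mono : StrictMono m
  zero : m 0 = 0
  len : ∀ s, (g s).length = m s.length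
  mono_prefix : ∀ s t : List Bool, s <+: t → g s <+: g t
  close : ∀ (k : ℕ) (s t : List Bool), s.length = k + 1 → t.length = k + 1 →
    s.getD k false = t.getD k false →
    dE2L (m k) (m (k + 1)) (g s) (g t) < 1 / 2 ^ (k + 2)
  far : ∀ (k : ℕ) (s t : List Bool), s.length = k + 1 → t.length = k + 1 →
    s.getD k false ≠ t.getD k false →
    |dE2L (m k) (m (k + 1)) (g s) (g t) - 1 / ((k : ℝ) + 1)| < 1 / 2 ^ (k + 2)

/-- The initial segment `x ↾ n` as a finite string. -/
def seg (x : ℕ → Bool) (n : ℕ) : List Bool := List.ofFn fun i : Fin n => x i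

/-- The map `Φ(x) = ⋃ₙ g(x ↾ n)` induced by an `E₂`-tree system. -/
def e2MapOf (g : List Bool → List Bool) (x : ℕ → Bool) : ℕ → Bool :=
  fun j => (g (seg x (j + 1))).getD j false

/-- `Φ` is an `E₂`-tree map. -/
def IsE2TreeMap (Φ : (ℕ → Bool) → (ℕ → Bool)) : Prop :=
  ∃ m g, IsE2System m g ∧ Φ = e2MapOf g

/-- `[B]³_{E₂}`: triples from `B` that are pairwise `E₂`-inequivalent. -/
def triplesE2 (B : Set (ℕ → Bool)) : Set ((ℕ → Bool) × (ℕ → Bool) × (ℕ → Bool)) :=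
  {p | p.1 ∈ B ∧ p.2.1 ∈ B ∧ p.2.2 ∈ B ∧
    ¬E2 p.1 p.2.1 ∧ ¬E2 p.1 p.2.2 ∧ ¬E2 p.2.1 p.2.2}

/-! ### Partial distances -/

/-- `δ_0^n` on infinite binary sequences. -/
noncomputable def e2Dist (x y : ℕ → Bool) (n : ℕ) : ℝ :=
  ∑ k ∈ Finset.range n, if x k = y k then 0 else 1 / ((k : ℝ) + 1)

theorem e2Dist_zero (x y : ℕ → Bool) : e2Dist x y 0 = 0 := by simp [e2Dist]

theorem e2Dist_succ (x y : ℕ → Bool) (n : ℕ) :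
    e2Dist x y (n + 1) = e2Dist x y n + if x n = y n then 0 else 1 / ((n : ℝ) + 1) :=
  Finset.sum_range_succ _ _

theorem e2Dist_term_nonneg (x y : ℕ → Bool) (k : ℕ) :
    (0 : ℝ) ≤ if x k = y k then 0 else 1 / ((k : ℝ) + 1) := by
  split_ifs <;> positivity

theorem e2Dist_self (x : ℕ → Bool) (n : ℕ) : e2Dist x x n = 0 := by simp [e2Dist]

theorem e2Dist_comm (x y : ℕ → Bool) (n : ℕ) : e2Dist x y n = e2Dist y x n := by
  simp only [e2Dist, eq_comm]

theorem e2Dist_mono (x y : ℕ → Bool) : Monotone (e2Dist x y) :=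
  monotone_nat_of_le_succ fun n => by
    rw [e2Dist_succ]; linarith [e2Dist_term_nonneg x y n]

theorem e2Dist_nonneg (x y : ℕ → Bool) (n : ℕ) : 0 ≤ e2Dist x y n :=
  Finset.sum_nonneg fun k _ => e2Dist_term_nonneg x y k

theorem e2Dist_congr {x y x' y' : ℕ → Bool} {n : ℕ} (hx : ∀ k < n, x k = x' k)
    (hy : ∀ k < n, y k = y' k) : e2Dist x y n = e2Dist x' y' n :=
  Finset.sum_congr rfl fun k hk => by
    rw [hx k (Finset.mem_range.1 hk), hy k (Finset.mem_range.1 hk)]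

/-- Triangle inequality on the window `[a, b)`. -/
theorem e2Dist_triangle_window (x y z : ℕ → Bool) {a b : ℕ} (h : a ≤ b) :
    e2Dist x z b - e2Dist x z a ≤
      (e2Dist x y b - e2Dist x y a) + (e2Dist y z b - e2Dist y z a) := by
  induction b, h using Nat.le_induction with
  | base => simp
  | succ n _ ih =>
    simp only [e2Dist_succ]
    have : (if x n = z n then (0 : ℝ) else 1 / ((n : ℝ) + 1)) ≤
        (if x n = y n then (0 : ℝ) else 1 / ((n : ℝ) + 1)) +
        if y n = z n then (0 : ℝ) else 1 / ((n : ℝ) + 1) := by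
      have : (0 : ℝ) ≤ 1 / ((n : ℝ) + 1) := by positivity
      split_ifs <;> simp_all
    linarith

theorem e2Dist_triangle (x y z : ℕ → Bool) (n : ℕ) :
    e2Dist x z n ≤ e2Dist x y n + e2Dist y z n := by
  simpa [e2Dist_zero] using e2Dist_triangle_window x y z (Nat.zero_le n)

theorem E2_of_e2Dist_le {x y : ℕ → Bool} {S : ℝ} (h : ∀ n, e2Dist x y n ≤ S) : E2 x y :=
  summable_of_sum_range_le (e2Dist_term_nonneg x y) h

theorem exists_lt_e2Dist {x y : ℕ → Bool} (h : ¬E2 x y) (M : ℝ) : ∃ n, M < e2Dist x y n := by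
  contrapose! h
  exact E2_of_e2Dist_le h

theorem E2.e2Dist_le_tsum {x y : ℕ → Bool} (h : E2 x y) (n : ℕ) :
    e2Dist x y n ≤ ∑' k, if x k = y k then (0 : ℝ) else 1 / ((k : ℝ) + 1) :=
  h.sum_le_tsum _ fun k _ => e2Dist_term_nonneg x y k

theorem E2.exists_tail_le {x y : ℕ → Bool} (h : E2 x y) :
    ∃ p, ∀ a ≥ p, ∀ n, e2Dist x y n ≤ e2Dist x y a + 1 := by
  have ht := h.hasSum.tendsto_sum_nat
  obtain ⟨p, hp⟩ := Filter.eventually_atTop.1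
    (ht.eventually (lt_mem_nhds (sub_one_lt (∑' k, if x k = y k then (0 : ℝ) else
      1 / ((k : ℝ) + 1)))))
  refine ⟨p, fun a ha n => ?_⟩
  have h1 : _ < e2Dist x y a := hp a ha
  linarith [h.e2Dist_le_tsum n]

theorem not_E2_of_unbounded {x y : ℕ → Bool} (h : ∀ M : ℕ, ∃ n, (M : ℝ) ≤ e2Dist x y n) :
    ¬E2 x y := by
  intro hE
  obtain ⟨M, hM⟩ := exists_nat_gt (∑' k, if x k = y k then (0 : ℝ) else 1 / ((k : ℝ) + 1))
  obtain ⟨n, hn⟩ := h M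
  linarith [hE.e2Dist_le_tsum n]

theorem E2_of_eventually_eq {x y : ℕ → Bool} {k : ℕ} (h : ∀ j ≥ k, x j = y j) : E2 x y := by
  refine summable_of_ne_finset_zero (s := Finset.range k) fun j hj => ?_
  rw [if_pos (h j (by simpa using hj))]

theorem tendsto_harmonic_sum : Filter.Tendsto
    (fun n : ℕ => ∑ k ∈ Finset.range n, 1 / ((k : ℝ) + 1)) Filter.atTop Filter.atTop :=
  Real.tendsto_sum_range_one_div_nat_succ_atTop

theorem not_E2_of_eventually_ne {x y : ℕ → Bool} {k : ℕ} (h : ∀ j ≥ k, x j ≠ y j) :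
    ¬E2 x y := by
  intro hE
  have : Summable fun j : ℕ => 1 / ((j : ℝ) + 1) := by
    rw [← summable_nat_add_iff k]
    refine ((summable_nat_add_iff k).2 hE).congr fun j => ?_
    rw [if_neg (h _ (Nat.le_add_left k j))]
  exact not_tendsto_nhds_of_tendsto_atTop tendsto_harmonic_sum _ this.hasSum.tendsto_sum_nat

/-! ### Triples -/

/-- A triple of sequences as a family over `Fin 3`. -/
def tripleFam (p : (ℕ → Bool) × (ℕ → Bool) × (ℕ → Bool)) : Fin 3 → ℕ → Bool :=
  ![p.1, p.2.1, p.2.2]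

/-- The partial distance of the two members of the family other than the `i`-th. -/
noncomputable def oppDist (X : Fin 3 → ℕ → Bool) (i : Fin 3) (n : ℕ) : ℝ :=
  e2Dist (X (i + 1)) (X (i + 2)) n

theorem oppDist_mono (X : Fin 3 → ℕ → Bool) (i : Fin 3) : Monotone (oppDist X i) :=
  e2Dist_mono _ _

theorem oppDist_eq (X : Fin 3 → ℕ → Bool) {r s t : Fin 3} (hrs : r ≠ s) (hrt : r ≠ t)
    (hst : s ≠ t) (n : ℕ) : oppDist X r n = e2Dist (X s) (X t) n := by
  have : (s = r + 1 ∧ t = r + 2) ∨ (t = r + 1 ∧ s = r + 2) := by decide +revert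
  rcases this with ⟨rfl, rfl⟩ | ⟨rfl, rfl⟩
  · rfl
  · exact e2Dist_comm _ _ _

theorem oppDist_congr {X Y : Fin 3 → ℕ → Bool} {n : ℕ} (h : ∀ i, ∀ k < n, X i k = Y i k)
    (i : Fin 3) : oppDist X i n = oppDist Y i n :=
  e2Dist_congr (h _) (h _)

theorem isOpen_of_forall_agree {S : Set ((ℕ → Bool) × (ℕ → Bool) × (ℕ → Bool))}
    (h : ∀ p ∈ S, ∃ n, ∀ q, (∀ i, ∀ k < n, tripleFam q i k = tripleFam p i k) → q ∈ S) :
    IsOpen S := by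
  refine isOpen_iff_mem_nhds.2 fun p hp => ?_
  obtain ⟨n, hn⟩ := h p hp
  have hc : ∀ x : ℕ → Bool, PiNat.cylinder x n ∈ nhds x := fun x =>
    (PiNat.isOpen_cylinder (fun _ => Bool) x n).mem_nhds (PiNat.self_mem_cylinder x n)
  refine Filter.mem_of_superset
    (prod_mem_nhds (hc p.1) (prod_mem_nhds (hc p.2.1) (hc p.2.2))) ?_
  rintro q ⟨h0, h1, h2⟩
  refine hn q fun i k hk => ?_
  fin_cases i
  exacts [h0 k hk, h1 k hk, h2 k hk]

/-! ### Leaders and the decoding map -/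

/-- The `i`-th member of the family leads at time `n` if the other two are closer to each other,
by at least `2`, than either of them is to the `i`-th. -/
def Leads (X : Fin 3 → ℕ → Bool) (i : Fin 3) (n : ℕ) : Prop :=
  ∀ r, r ≠ i → oppDist X i n + 2 ≤ oppDist X r n

theorem Leads.congr {X Y : Fin 3 → ℕ → Bool} {n : ℕ} (h : ∀ i, ∀ k < n, X i k = Y i k)
    (i : Fin 3) : Leads X i n ↔ Leads Y i n := by
  simp only [Leads, oppDist_congr h]

open Classical in
/-- Update a leader and the number of changes of leader, given who leads now. -/
noncomputable def leaderStep (P : Fin 3 → Prop) (s : Fin 3 × ℕ) : Fin 3 × ℕ :=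
  if P (s.1 + 1) then (s.1 + 1, s.2 + 1) else if P (s.1 + 2) then (s.1 + 2, s.2 + 1) else s

theorem leaderStep_eq_self {P : Fin 3 → Prop} {a : Fin 3} {c : ℕ} (h : ∀ r, r ≠ a → ¬P r) :
    leaderStep P (a, c) = (a, c) := by
  have h1 : a + 1 ≠ a := by clear * -; decide +revert
  have h2 : a + 2 ≠ a := by clear * -; decide +revert
  simp [leaderStep, h _ h1, h _ h2]

theorem leaderStep_eq_of_ne {P : Fin 3 → Prop} {a i : Fin 3} {c : ℕ} (hi : P i) (hne : i ≠ a)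
    (h : ∀ r, r ≠ a → r ≠ i → ¬P r) : leaderStep P (a, c) = (i, c + 1) := by
  by_cases hi1 : i = a + 1
  · subst hi1; simp [leaderStep, hi]
  · obtain rfl : i = a + 2 := by clear * - hi1 hne; decide +revert
    have h1 : a + 1 ≠ a ∧ a + 1 ≠ a + 2 := by clear * -; decide +revert
    simp [leaderStep, hi, h _ h1.1 h1.2]

/-- The current leader, together with the number of changes of leader so far. -/
noncomputable def leaderState (L : Fin 3 → ℕ → Prop) : ℕ → Fin 3 × ℕ
  | 0 => (0, 0)
  | n + 1 => leaderStep (fun i => L i (n + 1)) (leaderState L n)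

theorem leaderState_congr {L L' : Fin 3 → ℕ → Prop} {N : ℕ}
    (h : ∀ i, ∀ n ≤ N, (L i n ↔ L' i n)) : ∀ n ≤ N, leaderState L n = leaderState L' n := by
  intro n hn
  induction n with
  | zero => rfl
  | succ n ih => simp only [leaderState, ih (by omega), h _ _ hn]

/-- The sequence of leaders coding the infinite binary sequence `b`. -/
def leaderSeq (b : ℕ → Bool) : ℕ → Fin 3
  | 0 => 0
  | j + 1 => leaderSeq b j + if b j then 1 else 2

theorem leaderSeq_succ_ne (b : ℕ → Bool) (j : ℕ) : leaderSeq b (j + 1) ≠ leaderSeq b j := by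
  simp only [leaderSeq]
  generalize leaderSeq b j = a
  cases b j <;> decide +revert

theorem leaderSeq_succ_eq_iff (b : ℕ → Bool) (j : ℕ) :
    leaderSeq b (j + 1) = leaderSeq b j + 1 ↔ b j = true := by
  simp only [leaderSeq]
  generalize leaderSeq b j = a
  cases b j <;> decide +revert

theorem leaderState_eq_leaderSeq {L : Fin 3 → ℕ → Prop} {b : ℕ → Bool} {p : ℕ → ℕ}
    (hp0 : p 0 = 0) (hp : StrictMono p)
    (third : ∀ j t, p j ≤ t → t ≤ p (j + 1) → ∀ r, r ≠ leaderSeq b j →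
      r ≠ leaderSeq b (j + 1) → ¬L r t)
    (stable : ∀ j t t', p j ≤ t → t ≤ t' → t' ≤ p (j + 1) → L (leaderSeq b (j + 1)) t →
      ¬L (leaderSeq b j) t')
    (leads : ∀ j, L (leaderSeq b (j + 1)) (p (j + 1))) (j : ℕ) :
    leaderState L (p j) = (leaderSeq b j, j) ∧
      ∀ n ≤ p j, (leaderState L n).1 = leaderSeq b (leaderState L n).2 := by
  induction j with
  | zero =>
    refine ⟨by rw [hp0]; rfl, fun n hn => ?_⟩
    obtain rfl : n = 0 := by omega
    rfl
  | succ j ih =>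
    have hlt : p j < p (j + 1) := hp j.lt_succ_self
    have key : ∀ t, p j ≤ t → t ≤ p (j + 1) →
        (leaderState L t = (leaderSeq b j, j) ∧
          ∀ t', p j < t' → t' ≤ t → ¬L (leaderSeq b (j + 1)) t') ∨
        (leaderState L t = (leaderSeq b (j + 1), j + 1) ∧
          ∃ t', p j ≤ t' ∧ t' ≤ t ∧ L (leaderSeq b (j + 1)) t') := by
      intro t ht
      induction t, ht using Nat.le_induction with
      | base => exact fun _ => .inl ⟨ih.1, fun t' h h' => by omega⟩
      | succ t ht iht =>
        intro ht1
        have h3 := third j (t + 1) (by omega) ht1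
        have hst := fun t' h h' => stable j t' (t + 1) h h' ht1
        have hne := leaderSeq_succ_ne b j
        rcases iht (by omega) with ⟨hs, hno⟩ | ⟨hs, t', h1, h2, h4⟩
        · by_cases hL : L (leaderSeq b (j + 1)) (t + 1)
          · refine .inr ⟨?_, t + 1, by omega, le_rfl, hL⟩
            rw [leaderState, hs, leaderStep_eq_of_ne hL hne h3]
          · refine .inl ⟨?_, fun t' h h' => ?_⟩
            · rw [leaderState, hs, leaderStep_eq_self]
              intro r hr
              by_cases hri : r = leaderSeq b (j + 1)
              · exact hri ▸ hL
              · exact h3 r hr hri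
            · rcases h'.eq_or_lt with rfl | h'
              · exact hL
              · exact hno t' h (by omega)
        · refine .inr ⟨?_, t', h1, by omega, h4⟩
          have := hst t' h1 (by omega) h4
          rw [leaderState, hs, leaderStep_eq_self]
          intro r hr
          by_cases hri : r = leaderSeq b j
          · exact hri ▸ this
          · exact h3 r hri hr
    refine ⟨?_, fun n hn => ?_⟩
    · rcases key _ hlt.le le_rfl with ⟨-, h⟩ | ⟨h, -⟩
      · exact absurd (leads j) (h _ hlt le_rfl)
      · exact h
    · rcases le_total n (p j) with h | h
      · exact ih.2 n h
      · rcases key n h hn with ⟨h, -⟩ | ⟨h, -⟩ <;> rw [h]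

open Classical in
/-- The `j`-th bit records in which direction the leader changes for the `j`-th time. -/
noncomputable def decodeLeaders (p : (ℕ → Bool) × (ℕ → Bool) × (ℕ → Bool)) (j : ℕ) : Bool :=
  decide (∃ n m, (leaderState (Leads (tripleFam p)) n).2 = j ∧
    (leaderState (Leads (tripleFam p)) m).2 = j + 1 ∧
    (leaderState (Leads (tripleFam p)) m).1 = (leaderState (Leads (tripleFam p)) n).1 + 1)

theorem measurable_decodeLeaders : Measurable decodeLeaders := by
  refine measurable_pi_lambda _ fun j => measurable_to_bool (IsOpen.measurableSet ?_)
  refine isOpen_of_forall_agree fun p hp => ?_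
  simp only [mem_preimage, mem_singleton_iff, decodeLeaders, decide_eq_true_eq] at hp ⊢
  obtain ⟨n, m, h⟩ := hp
  refine ⟨max n m, fun q hq => ⟨n, m, ?_⟩⟩
  have hL : ∀ t ≤ max n m, leaderState (Leads (tripleFam q)) t =
      leaderState (Leads (tripleFam p)) t :=
    leaderState_congr fun i t ht => Leads.congr (fun i k hk => hq i k (by omega)) i
  rwa [hL n (le_max_left _ _), hL m (le_max_right _ _)]

theorem decodeLeaders_eq {q : (ℕ → Bool) × (ℕ → Bool) × (ℕ → Bool)} {b : ℕ → Bool} {p : ℕ → ℕ}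
    (hp0 : p 0 = 0) (hp : StrictMono p)
    (third : ∀ j t, p j ≤ t → t ≤ p (j + 1) → ∀ r, r ≠ leaderSeq b j →
      r ≠ leaderSeq b (j + 1) → ¬Leads (tripleFam q) r t)
    (stable : ∀ j t t', p j ≤ t → t ≤ t' → t' ≤ p (j + 1) →
      Leads (tripleFam q) (leaderSeq b (j + 1)) t → ¬Leads (tripleFam q) (leaderSeq b j) t')
    (leads : ∀ j, Leads (tripleFam q) (leaderSeq b (j + 1)) (p (j + 1))) :
    decodeLeaders q = b := by
  have key := leaderState_eq_leaderSeq hp0 hp third stable leads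
  have hall : ∀ n, (leaderState (Leads (tripleFam q)) n).1 =
      leaderSeq b (leaderState (Leads (tripleFam q)) n).2 := fun n => (key n).2 n hp.le_apply
  funext j
  rw [Bool.eq_iff_iff]
  simp only [decodeLeaders, decide_eq_true_eq]
  rw [← leaderSeq_succ_eq_iff]
  constructor
  · rintro ⟨n, m, h1, h2, h3⟩
    rwa [hall, hall, h1, h2] at h3
  · intro h
    refine ⟨p j, p (j + 1), ?_⟩
    rw [(key j).1, (key (j + 1)).1]
    exact ⟨rfl, rfl, h⟩

/-! ### Borel reductions on a residual set -/

theorem exists_agree_subset_of_mem_nhds {x : ℕ → Bool} {U : Set (ℕ → Bool)} (h : U ∈ nhds x) :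
    ∃ l, ∀ v : ℕ → Bool, (∀ k < l, v k = x k) → v ∈ U := by
  obtain ⟨_, ⟨y, n, rfl⟩, hx, hU⟩ :=
    (PiNat.isTopologicalBasis_cylinders fun _ : ℕ => Bool).mem_nhds_iff.1 h
  exact ⟨n, fun v hv => hU fun k hk => (hv k hk).trans (hx k hk)⟩

theorem ContinuousOn.exists_agree {f : (ℕ → Bool) → ℕ → Bool} {C : Set (ℕ → Bool)}
    (hf : ContinuousOn f C) {u : ℕ → Bool} (hu : u ∈ C) (p : ℕ) :
    ∃ l, ∀ v ∈ C, (∀ k < l, v k = u k) → ∀ k < p, f v k = f u k := by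
  have h : f ⁻¹' PiNat.cylinder (f u) p ∈ nhdsWithin u C :=
    hf u hu ((PiNat.isOpen_cylinder (fun _ => Bool) (f u) p).mem_nhds
      (PiNat.self_mem_cylinder (f u) p))
  obtain ⟨U, hU, hUC⟩ := mem_nhdsWithin_iff_exists_mem_nhds_inter.1 h
  obtain ⟨l, hl⟩ := exists_agree_subset_of_mem_nhds hU
  exact ⟨l, fun v hv hvu => hUC ⟨hl v hvu, hv⟩⟩

theorem exists_residual_continuousOn {f : (ℕ → Bool) → ℕ → Bool} (hf : Measurable f) :
    ∃ C ∈ residual (ℕ → Bool), ContinuousOn f C := by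
  have hU : ∀ (j : ℕ) (c : Bool), ∃ U : Set (ℕ → Bool), IsOpen U ∧
      {x | f x j = c} =ᶠ[residual _] U := fun j c =>
    MeasurableSet.residualEq_isOpen
      (((measurable_pi_apply j).comp hf) (measurableSet_singleton c))
  choose U hUo hU using hU
  refine ⟨⋂ (j : ℕ) (c : Bool), {x | f x j = c ↔ x ∈ U j c}, ?_, ?_⟩
  · refine countable_iInter_mem.2 fun j => countable_iInter_mem.2 fun c => ?_
    exact Filter.eventuallyEq_set.1 (hU j c)
  · refine continuousOn_pi.2 fun j x hx => ?_
    have hC : ∀ {y}, y ∈ (⋂ (j : ℕ) (c : Bool), {x | f x j = c ↔ x ∈ U j c}) → ∀ c,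
        (f y j = c ↔ y ∈ U j c) := fun hy c => mem_iInter.1 (mem_iInter.1 hy j) c
    refine (continuousWithinAt_const (b := f x j)).congr_of_eventuallyEq ?_ rfl
    have hxU : U j (f x j) ∈ nhds x := (hUo j _).mem_nhds ((hC hx _).1 rfl)
    filter_upwards [mem_nhdsWithin_of_mem_nhds hxU, self_mem_nhdsWithin] with y hy hyC
    exact (hC hyC _).2 hy

/-- `v` is eventually equal to `u` or eventually equal to the complement of `u`. -/
def FlipEquiv (u v : ℕ → Bool) : Prop :=
  ∃ (k : ℕ) (c : Bool), ∀ j ≥ k, v j = xor (u j) c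

theorem xor_const_residual {C : Set (ℕ → Bool)} (hC : C ∈ residual (ℕ → Bool)) (γ : ℕ → Bool) :
    {u : ℕ → Bool | (fun j => xor (u j) (γ j)) ∈ C} ∈ residual (ℕ → Bool) := by
  have hc : Continuous fun (u : ℕ → Bool) j => xor (u j) (γ j) :=
    continuous_pi fun j => (continuous_of_discreteTopology (f := fun a => xor a (γ j))).comp
      (continuous_apply j)
  let e : (ℕ → Bool) ≃ₜ (ℕ → Bool) :=
    { toFun := fun u j => xor (u j) (γ j)
      invFun := fun u j => xor (u j) (γ j)
      left_inv := fun u => by simp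
      right_inv := fun u => by simp
      continuous_toFun := hc
      continuous_invFun := hc }
  exact tendsto_residual_of_isOpenMap e.continuous e.isOpenMap hC

theorem exists_forall_flipEquiv_mem {C : Set (ℕ → Bool)} (hC : C ∈ residual (ℕ → Bool)) :
    ∃ u, ∀ v, FlipEquiv u v → v ∈ C := by
  have h : (⋂ (s : List Bool) (c : Bool),
      {u : ℕ → Bool | (fun j => xor (u j) (s.getD j c)) ∈ C}) ∈ residual (ℕ → Bool) :=
    countable_iInter_mem.2 fun s => countable_iInter_mem.2 fun c => xor_const_residual hC _
  obtain ⟨u, hu⟩ := (dense_of_mem_residual h).nonempty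
  refine ⟨u, fun v ⟨k, c, hv⟩ => ?_⟩
  have hmem := mem_iInter.1 (mem_iInter.1 hu (List.ofFn fun i : Fin k => xor (u i) (v i))) c
  have heq : v = fun j => xor (u j) ((List.ofFn fun i : Fin k => xor (u i) (v i)).getD j c) := by
    funext j
    by_cases hj : j < k
    · simp [List.getD_eq_getElem?_getD, hj]
    · simp [List.getD_eq_getElem?_getD, hj, hv j (by omega)]
  rw [heq]
  exact hmem

theorem exists_far_image {f : (ℕ → Bool) → ℕ → Bool} {C : Set (ℕ → Bool)}
    (hf : ContinuousOn f C) (hred : ∀ x y, E2 (f x) (f y) → E2 x y) {u : ℕ → Bool}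
    (hu : ∀ v, FlipEquiv u v → v ∈ C) (l : ℕ) (M : ℝ) :
    ∃ u', (∀ k < l, u' k = u k) ∧ (∃ k, ∀ j ≥ k, u' j = u j) ∧
      ∃ n, M < e2Dist (f u) (f u') n := by
  let v : ℕ → Bool := fun j => if j < l then u j else !(u j)
  have hvC : v ∈ C := hu v ⟨l, true, fun j hj => by simp [v, Nat.not_lt.2 hj]⟩
  have hnE : ¬E2 (f u) (f v) := fun h =>
    not_E2_of_eventually_ne (k := l) (fun j hj => by simp [v, Nat.not_lt.2 hj]) (hred _ _ h)
  obtain ⟨n, hn⟩ := exists_lt_e2Dist hnE M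
  obtain ⟨k, hk⟩ := hf.exists_agree hvC n
  refine ⟨fun j => if j < k then v j else u j, fun j hj => ?_, ⟨k, fun j hj => ?_⟩, n, ?_⟩
  · simp [v, hj]
  · simp [Nat.not_lt.2 hj]
  · rw [e2Dist_congr (fun _ _ => rfl) (hk _ (hu _ ⟨k, false, fun j hj => ?_⟩) fun j hj => ?_)]
    · exact hn
    · simp [Nat.not_lt.2 hj]
    · simp [hj]

/-! ### Construction of a triple with prescribed leaders -/

/-- The invariant kept while building a triple with prescribed leaders: `q` is the current triple,
its image is decided below `p` by the first `l` values of the members of `q`. -/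
structure StageInvariant (f : (ℕ → Bool) → ℕ → Bool) (C : Set (ℕ → Bool))
    (D : ℕ → Set (ℕ → Bool)) (u : ℕ → Bool) (a : Fin 3) (j : ℕ)
    (q : Fin 3 → ℕ → Bool) (p l : ℕ) : Prop where
  eventually_eq : ∀ i, ∃ k, ∀ m ≥ k, q i m = u m
  closest : ∀ r, oppDist (fun i => f (q i)) a p ≤ oppDist (fun i => f (q i)) r p
  tail : ∀ r n, oppDist (fun i => f (q i)) r n ≤ oppDist (fun i => f (q i)) r p + 1
  le_length : j ≤ l
  mem : ∀ i v, (∀ k < l, v k = q i k) → v ∈ D j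
  agree : ∀ i, ∀ v ∈ C, (∀ k < l, v k = q i k) → ∀ k < p, f v k = f (q i) k

/-- The leader changes from `a` to `i` on the window `[p, p']`, with no other leader occurring. -/
structure LeaderChange (X : Fin 3 → ℕ → Bool) (a i : Fin 3) (j p p' : ℕ) : Prop where
  third : ∀ t, p ≤ t → t ≤ p' → ∀ r, r ≠ a → r ≠ i → ¬Leads X r t
  stable : ∀ t t', p ≤ t → t ≤ t' → t' ≤ p' → Leads X i t → ¬Leads X a t'
  leads : Leads X i p'
  large : ∀ r, r ≠ i → (j : ℝ) ≤ oppDist X r p'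

theorem LeaderChange.congr {X Y : Fin 3 → ℕ → Bool} {a i : Fin 3} {j p p' : ℕ}
    (h : ∀ r, ∀ k < p', X r k = Y r k) (hX : LeaderChange X a i j p p') :
    LeaderChange Y a i j p p' := by
  have hL : ∀ r, ∀ t ≤ p', (Leads X r t ↔ Leads Y r t) := fun r t ht =>
    Leads.congr (fun s k hk => h s k (by omega)) r
  refine ⟨fun t ht ht' r hr hri => ?_, fun t t' h1 h2 h3 h4 => ?_, ?_, fun r hr => ?_⟩
  · exact (hL r t ht').not.1 (hX.third t ht ht' r hr hri)
  · exact (hL a t' h3).not.1 (hX.stable t t' h1 h2 h3 ((hL i t (h2.trans h3)).2 h4))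
  · exact (hL i p' le_rfl).1 hX.leads
  · rw [← oppDist_congr h]; exact hX.large r hr

theorem leaderChange_of_dist {X X' : Fin 3 → ℕ → Bool} {a i : Fin 3} {j p p' : ℕ} {S : ℝ}
    (hia : i ≠ a) (hX : ∀ r, r ≠ i → X' r = X r)
    (hagree : ∀ k < p, X' i k = X i k)
    (closest : ∀ r, oppDist X a p ≤ oppDist X r p)
    (tail : ∀ n, oppDist X i n ≤ oppDist X i p + 1)
    (hS : ∀ r s n, e2Dist (X r) (X s) n ≤ S)
    (far : 2 * S + 2 + j < e2Dist (X i) (X' i) p') : LeaderChange X' a i j p p' := by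
  have hag : ∀ s, ∀ k < p, X' s k = X s k := fun s k hk => by
    by_cases hs : s = i
    · subst hs; exact hagree k hk
    · rw [hX s hs]
  have hoi : ∀ n, oppDist X' i n = oppDist X i n := fun n => by
    simp only [oppDist]
    rw [hX, hX] <;> (clear * -; decide +revert)
  have hS0 : 0 ≤ S := (e2Dist_nonneg _ _ 0).trans (hS 0 0 0)
  have hlarge : ∀ r, r ≠ i → S + 2 + j ≤ oppDist X' r p' := by
    intro r hr
    obtain ⟨s, hsr, hsi⟩ : ∃ s : Fin 3, s ≠ r ∧ s ≠ i := by clear * -; decide +revert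
    rw [oppDist_eq X' hr hsr.symm hsi.symm, hX s hsi]
    have := e2Dist_triangle (X i) (X s) (X' i) p'
    rw [e2Dist_comm (X s)] at this
    linarith [hS i s p']
  refine ⟨fun t ht ht' r hra hri hL => ?_, fun t t' h1 h2 h3 h4 h5 => ?_, fun r hr => ?_,
    fun r hr => ?_⟩
  · have h := hL a hra.symm
    rw [oppDist_eq X' hra hri hia.symm, oppDist_eq X' hia.symm hra.symm hri.symm] at h
    have h6 := e2Dist_triangle_window (X' i) (X' a) (X' r) ht
    have h7 := closest r
    rw [← oppDist_congr hag, ← oppDist_congr hag, oppDist_eq X' hra hri hia.symm,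
      oppDist_eq X' hia.symm hra.symm hri.symm] at h7
    have h8 := tail t
    rw [← hoi, ← hoi] at h8
    simp only [oppDist_eq X' hia hri.symm hra.symm] at h8
    simp only [e2Dist_comm (X' i) (X' a)] at h6
    linarith
  · have h6 := h4 a hia.symm
    have h7 := h5 i hia
    have h8 := tail t'
    rw [← hoi, ← hoi] at h8
    linarith [oppDist_mono X' a h2, oppDist_mono X' i h1]
  · have : oppDist X' i p' ≤ S := by rw [hoi]; exact hS _ _ _
    linarith [hlarge r hr, (Nat.cast_nonneg j : (0 : ℝ) ≤ j)]
  · linarith [hlarge r hr]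

theorem StageInvariant.exists_next {f : (ℕ → Bool) → ℕ → Bool} {C : Set (ℕ → Bool)}
    {D : ℕ → Set (ℕ → Bool)} {u : ℕ → Bool} {a i : Fin 3} {j : ℕ} {q : Fin 3 → ℕ → Bool}
    {p l : ℕ} (hf : ContinuousOn f C) (hom : ∀ x y, E2 x y ↔ E2 (f x) (f y))
    (hu : ∀ v, FlipEquiv u v → v ∈ C) (hDo : ∀ n, IsOpen (D n)) (hCD : ∀ n, C ⊆ D n)
    (hia : i ≠ a) (h : StageInvariant f C D u a j q p l) :
    ∃ q' p' l', StageInvariant f C D u i (j + 1) q' p' l' ∧ p < p' ∧ l ≤ l' ∧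
      (∀ r, ∀ k < l, q' r k = q r k) ∧ LeaderChange (fun r => f (q' r)) a i j p p' := by
  have hE : ∀ {q : Fin 3 → ℕ → Bool}, (∀ r, ∃ k, ∀ m ≥ k, q r m = u m) → ∀ r s,
      E2 (f (q r)) (f (q s)) := fun hq r s => by
    obtain ⟨k, hk⟩ := hq r
    obtain ⟨k', hk'⟩ := hq s
    refine (hom _ _).1 (E2_of_eventually_eq (k := max k k') fun m hm => ?_)
    rw [hk m (by omega), hk' m (by omega)]
  obtain ⟨S, hS⟩ : ∃ S, ∀ r s n, e2Dist (f (q r)) (f (q s)) n ≤ S := by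
    obtain ⟨S, hS⟩ := (finite_range fun rs : Fin 3 × Fin 3 =>
      ∑' k, if f (q rs.1) k = f (q rs.2) k then (0 : ℝ) else 1 / ((k : ℝ) + 1)).bddAbove
    exact ⟨S, fun r s n => ((hE h.eventually_eq r s).e2Dist_le_tsum n).trans
      (hS ⟨(r, s), rfl⟩)⟩
  obtain ⟨k₀, hk₀⟩ := h.eventually_eq i
  obtain ⟨u', hu'l, ⟨k₁, hk₁⟩, n, hn⟩ := exists_far_image hf (fun x y => (hom x y).2)
    (u := q i) (fun v ⟨k, c, hv⟩ => hu v ⟨max k k₀, c, fun m hm => by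
      rw [hv m (by omega), hk₀ m (by omega)]⟩) l (2 * S + 2 + j)
  have hqi : update q i u' i = u' := update_self ..
  have hqr : ∀ r, r ≠ i → update q i u' r = q r := fun r hr => update_of_ne hr ..
  generalize update q i u' = q' at hqi hqr
  have hev : ∀ r, ∃ k, ∀ m ≥ k, q' r m = u m := fun r => by
    by_cases hr : r = i
    · subst hr
      exact ⟨max k₀ k₁, fun m hm => by rw [hqi, hk₁ m (by omega), hk₀ m (by omega)]⟩
    · rw [hqr r hr]; exact h.eventually_eq r
  have hC : ∀ r, q' r ∈ C := fun r => by
    obtain ⟨k, hk⟩ := hev r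
    exact hu _ ⟨k, false, fun m hm => by simp [hk m hm]⟩
  have hql : ∀ r, ∀ k < l, q' r k = q r k := fun r k hk => by
    by_cases hr : r = i
    · subst hr; rw [hqi, hu'l k hk]
    · rw [hqr r hr]
  choose P hP using fun r : Fin 3 => (hE hev (r + 1) (r + 2)).exists_tail_le
  let p' := max (max (p + 1) n) (Finset.univ.sup P)
  have hPp : ∀ r, P r ≤ p' := fun r => (Finset.le_sup (Finset.mem_univ r)).trans (le_max_right _ _)
  have hpp' : p + 1 ≤ p' := (le_max_left _ _).trans (le_max_left _ _)
  have hnp' : n ≤ p' := (le_max_right _ _).trans (le_max_left _ _)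
  have hchange : LeaderChange (fun r => f (q' r)) a i j p p' :=
    leaderChange_of_dist (X := fun r => f (q r)) hia (fun r hr => by simp only [hqr r hr])
      (h.agree i _ (hC i) (hql i)) h.closest (h.tail i) hS
      (by rw [hqi]; exact hn.trans_le (e2Dist_mono _ _ hnp'))
  choose l₁ hl₁ using fun r =>
    exists_agree_subset_of_mem_nhds ((hDo (j + 1)).mem_nhds (hCD (j + 1) (hC r)))
  choose l₂ hl₂ using fun r => hf.exists_agree (hC r) p'
  let l' := max (max l (j + 1)) (max (Finset.univ.sup l₁) (Finset.univ.sup l₂))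
  have hl₁' : ∀ r, l₁ r ≤ l' := fun r => (Finset.le_sup (Finset.mem_univ r)).trans
    ((le_max_left _ _).trans (le_max_right _ _))
  have hl₂' : ∀ r, l₂ r ≤ l' := fun r => (Finset.le_sup (Finset.mem_univ r)).trans
    ((le_max_right _ _).trans (le_max_right _ _))
  refine ⟨q', p', l', ⟨hev, fun r => ?_, fun r m => hP r p' (hPp r) m,
    (le_max_right _ _).trans (le_max_left _ _), fun r v hv => ?_, fun r v hvC hv => ?_⟩,
    hpp', (le_max_left _ _).trans (le_max_left _ _), hql, hchange⟩
  · by_cases hr : r = i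
    · rw [hr]
    · linarith [hchange.leads r hr]
  · exact hl₁ r v fun k hk => hv k (hk.trans_le (hl₁' r))
  · exact hl₂ r v hvC fun k hk => hv k (hk.trans_le (hl₂' r))

theorem exists_triple_decodeLeaders_eq {f : (ℕ → Bool) → ℕ → Bool} (hf : Measurable f)
    (hom : ∀ x y, E2 x y ↔ E2 (f x) (f y)) (b : ℕ → Bool) :
    ∃ t ∈ triplesE2 (range f), decodeLeaders t = b := by
  obtain ⟨C₀, hC₀, hf₀⟩ := exists_residual_continuousOn hf
  obtain ⟨C, hCC₀, hCG, hCd⟩ := mem_residual.1 hC₀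
  have hfC : ContinuousOn f C := hf₀.mono hCC₀
  obtain ⟨D, hDo, hCD⟩ := isGδ_iff_eq_iInter_nat.1 hCG
  have hCD' : ∀ n, C ⊆ D n := fun n => hCD ▸ iInter_subset D n
  obtain ⟨u, hu⟩ := exists_forall_flipEquiv_mem (residual_of_dense_Gδ hCG hCd)
  have huC : u ∈ C := hu u ⟨0, false, by simp⟩
  obtain ⟨l₀, hl₀⟩ := exists_agree_subset_of_mem_nhds ((hDo 0).mem_nhds (hCD' 0 huC))
  have h0 : StageInvariant f C D u (leaderSeq b 0) 0 (fun _ => u) 0 l₀ :=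
    { eventually_eq := fun _ => ⟨0, fun _ _ => rfl⟩
      closest := by simp [oppDist, e2Dist_zero]
      tail := by simp [oppDist, e2Dist_self]
      le_length := Nat.zero_le _
      mem := fun _ => hl₀
      agree := by simp }
  choose! q' p' l' hnext using fun (j : ℕ) (q : Fin 3 → ℕ → Bool) (p l : ℕ)
    (h : StageInvariant f C D u (leaderSeq b j) j q p l) =>
      h.exists_next hfC hom hu hDo hCD' (leaderSeq_succ_ne b j)
  let s : ℕ → (Fin 3 → ℕ → Bool) × ℕ × ℕ := fun n => Nat.rec (fun _ => u, 0, l₀)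
    (fun j s => (q' j s.1 s.2.1 s.2.2, p' j s.1 s.2.1 s.2.2, l' j s.1 s.2.1 s.2.2)) n
  have hinv : ∀ j, StageInvariant f C D u (leaderSeq b j) j (s j).1 (s j).2.1 (s j).2.2 := by
    intro j
    induction j with
    | zero => exact h0
    | succ j ih => exact (hnext j _ _ _ ih).1
  have hp : StrictMono fun j => (s j).2.1 := strictMono_nat_of_lt_succ fun j =>
    (hnext j _ _ _ (hinv j)).2.1
  have hl : Monotone fun j => (s j).2.2 := monotone_nat_of_le_succ fun j =>
    (hnext j _ _ _ (hinv j)).2.2.1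
  have hq : ∀ j m, j ≤ m → ∀ r, ∀ k < (s j).2.2, (s m).1 r k = (s j).1 r k := by
    intro j m hm
    induction m, hm using Nat.le_induction with
    | base => exact fun _ _ _ => rfl
    | succ m hm ih =>
      intro r k hk
      rw [← ih r k hk]
      exact (hnext m _ _ _ (hinv m)).2.2.2.1 r k (hk.trans_le (hl hm))
  let z : Fin 3 → ℕ → Bool := fun r k => (s (k + 1)).1 r k
  have hz : ∀ j r, ∀ k < (s j).2.2, z r k = (s j).1 r k := by
    intro j r k hk
    rcases le_total j (k + 1) with h | h
    · exact hq j (k + 1) h r k hk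
    · exact (hq (k + 1) j h r k ((Nat.lt_succ_self k).trans_le (hinv (k + 1)).le_length)).symm
  have hzC : ∀ r, z r ∈ C := fun r => by
    rw [hCD]
    exact mem_iInter.2 fun j => (hinv j).mem r _ (hz j r)
  let t : (ℕ → Bool) × (ℕ → Bool) × (ℕ → Bool) := (f (z 0), f (z 1), f (z 2))
  have ht : ∀ r, tripleFam t r = f (z r) := fun r => by fin_cases r <;> rfl
  have hchange : ∀ j, LeaderChange (tripleFam t) (leaderSeq b j) (leaderSeq b (j + 1)) j
      (s j).2.1 (s (j + 1)).2.1 := fun j =>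
    (hnext j _ _ _ (hinv j)).2.2.2.2.congr fun r k hk => by
      rw [ht]
      exact ((hinv (j + 1)).agree r _ (hzC r) (hz (j + 1) r) k hk).symm
  have hdiv : ∀ r₁ r₂, r₁ ≠ r₂ → ¬E2 (tripleFam t r₁) (tripleFam t r₂) := by
    intro r₁ r₂ hr
    obtain ⟨r, hr1, hr2⟩ : ∃ r : Fin 3, r ≠ r₁ ∧ r ≠ r₂ := by clear * -; decide +revert
    refine not_E2_of_unbounded fun M => ?_
    by_cases h : r = leaderSeq b (M + 1)
    · refine ⟨(s (M + 1 + 1)).2.1, ?_⟩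
      rw [← oppDist_eq _ hr1 hr2 hr]
      refine le_trans ?_ ((hchange (M + 1)).large r (h ▸ (leaderSeq_succ_ne b _).symm))
      push_cast; linarith
    · refine ⟨(s (M + 1)).2.1, ?_⟩
      rw [← oppDist_eq _ hr1 hr2 hr]
      exact (hchange M).large r h
  refine ⟨t, ⟨mem_range_self _, mem_range_self _, mem_range_self _, hdiv 0 1 (by decide),
    hdiv 0 2 (by decide), hdiv 1 2 (by decide)⟩, ?_⟩
  exact decodeLeaders_eq (p := fun j => (s j).2.1) rfl hp (fun j => (hchange j).third)
    (fun j => (hchange j).stable) (fun j => (hchange j).leads)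

/-! ### A continuous decoding map -/

/-- The thresholds at which bits are read off. -/
def threshold (j : ℕ) : ℝ := 6 * 8 ^ (2 * j + 1)

theorem threshold_pos (j : ℕ) : 0 < threshold j := by unfold threshold; positivity

open Classical in
/-- The `j`-th bit compares two of the distances at the moment the third one crosses the `j`-th
threshold. -/
noncomputable def decodeCrossings (p : (ℕ → Bool) × (ℕ → Bool) × (ℕ → Bool)) (j : ℕ) : Bool :=
  decide (∃ n, oppDist (tripleFam p) 2 n < threshold j ∧
    threshold j ≤ oppDist (tripleFam p) 2 (n + 1) ∧
    oppDist (tripleFam p) 1 n ≤ oppDist (tripleFam p) 0 n)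

theorem decodeCrossings_eq_true_iff {p : (ℕ → Bool) × (ℕ → Bool) × (ℕ → Bool)} {j n : ℕ}
    (h1 : oppDist (tripleFam p) 2 n < threshold j)
    (h2 : threshold j ≤ oppDist (tripleFam p) 2 (n + 1)) :
    decodeCrossings p j = true ↔ oppDist (tripleFam p) 1 n ≤ oppDist (tripleFam p) 0 n := by
  simp only [decodeCrossings, decide_eq_true_eq]
  refine ⟨fun ⟨n', h1', h2', h⟩ => ?_, fun h => ⟨n, h1, h2, h⟩⟩
  obtain rfl : n' = n := by
    have hm := oppDist_mono (tripleFam p) 2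
    have h3 := hm.reflect_lt (h1.trans_le h2')
    have h4 := hm.reflect_lt (h1'.trans_le h2)
    omega
  exact h

theorem exists_crossing {p : (ℕ → Bool) × (ℕ → Bool) × (ℕ → Bool)} (h : ¬E2 p.1 p.2.1) (j : ℕ) :
    ∃ n, oppDist (tripleFam p) 2 n < threshold j ∧
      threshold j ≤ oppDist (tripleFam p) 2 (n + 1) := by
  have hex : ∃ n, threshold j ≤ oppDist (tripleFam p) 2 n :=
    (exists_lt_e2Dist h (threshold j)).imp fun n hn => hn.le
  classical
  have hspec := Nat.find_spec hex
  have hmin := @Nat.find_min _ _ hex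
  rcases hn : Nat.find hex with _ | n
  · rw [hn, oppDist, e2Dist_zero] at hspec
    exact absurd hspec (threshold_pos j).not_ge
  · exact ⟨n, not_le.1 (hmin (by omega)), hn ▸ hspec⟩

theorem continuousOn_decodeCrossings : ContinuousOn decodeCrossings (triplesE2 univ) := by
  refine continuousOn_pi.2 fun j p hp => ?_
  obtain ⟨n, h1, h2⟩ := exists_crossing hp.2.2.2.1 j
  refine ContinuousAt.continuousWithinAt ?_
  refine (continuousAt_const (y := decodeCrossings p j)).congr ?_
  have hopen : IsOpen {q | ∀ i, ∀ k < n + 1, tripleFam q i k = tripleFam p i k} :=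
    isOpen_of_forall_agree fun q hq =>
      ⟨n + 1, fun q' hq' i k hk => (hq' i k hk).trans (hq i k hk)⟩
  filter_upwards [hopen.mem_nhds fun _ _ _ => rfl] with q hq
  have hle : ∀ i, oppDist (tripleFam q) i n = oppDist (tripleFam p) i n :=
    oppDist_congr fun i k hk => hq i k (by omega)
  rw [Bool.eq_iff_iff, decodeCrossings_eq_true_iff h1 h2,
    decodeCrossings_eq_true_iff (by rwa [hle]) (by rwa [oppDist_congr hq]), hle, hle]

/-! ### Distances in the range of an `E₂`-tree map -/

theorem length_seg (x : ℕ → Bool) (n : ℕ) : (seg x n).length = n := by simp [seg]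

theorem getD_seg (x : ℕ → Bool) {n k : ℕ} (h : k < n) : (seg x n).getD k false = x k := by
  simp [seg, List.getD_eq_getElem?_getD, h]

theorem seg_prefix_seg (x : ℕ → Bool) {n n' : ℕ} (h : n ≤ n') : seg x n <+: seg x n' := by
  rw [List.prefix_iff_eq_take]
  refine List.ext_getElem (by simp [seg, h]) fun k h1 h2 => by simp [seg]

theorem getD_eq_of_prefix_of_lt {s t : List Bool} (h : s <+: t) {j : ℕ} (hj : j < s.length) :
    t.getD j false = s.getD j false := by
  obtain ⟨r, rfl⟩ := h
  exact List.getD_append _ _ _ _ hj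

namespace IsE2System

variable {m : ℕ → ℕ} {g : List Bool → List Bool}

theorem e2MapOf_eq (h : IsE2System m g) (x : ℕ → Bool) {j k : ℕ} (hj : j < m k) :
    e2MapOf g x j = (g (seg x k)).getD j false := by
  have hj' : j < m (j + 1) := (Nat.lt_succ_self j).trans_le h.mono.le_apply
  rcases le_total k (j + 1) with hk | hk
  · exact getD_eq_of_prefix_of_lt (h.mono_prefix _ _ (seg_prefix_seg x hk)) (by rwa [h.len, length_seg])
  · exact (getD_eq_of_prefix_of_lt (h.mono_prefix _ _ (seg_prefix_seg x hk))
      (by rwa [h.len, length_seg])).symm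

theorem e2Dist_block (h : IsE2System m g) (x y : ℕ → Bool) (k : ℕ) :
    e2Dist (e2MapOf g x) (e2MapOf g y) (m (k + 1)) = e2Dist (e2MapOf g x) (e2MapOf g y) (m k) +
      dE2L (m k) (m (k + 1)) (g (seg x (k + 1))) (g (seg y (k + 1))) := by
  rw [e2Dist, e2Dist, dE2L,
    ← Finset.sum_range_add_sum_Ico _ (h.mono.monotone (Nat.le_succ k))]
  congr 1
  refine Finset.sum_congr rfl fun j hj => ?_
  rw [h.e2MapOf_eq x (Finset.mem_Ico.1 hj).2, h.e2MapOf_eq y (Finset.mem_Ico.1 hj).2]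

theorem abs_e2Dist_sub_le (h : IsE2System m g) (x y : ℕ → Bool) (n : ℕ) :
    |e2Dist (e2MapOf g x) (e2MapOf g y) (m n) - e2Dist x y n| ≤ 1 / 2 - 1 / 2 ^ (n + 1) := by
  induction n with
  | zero => simp [h.zero, e2Dist_zero]
  | succ n ih =>
    rw [h.e2Dist_block, e2Dist_succ]
    have hd : |dE2L (m n) (m (n + 1)) (g (seg x (n + 1))) (g (seg y (n + 1))) -
        if x n = y n then 0 else 1 / ((n : ℝ) + 1)| < 1 / 2 ^ (n + 2) := by
      have hx := getD_seg x (Nat.lt_succ_self n)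
      have hy := getD_seg y (Nat.lt_succ_self n)
      split_ifs with hxy
      · rw [sub_zero, abs_of_nonneg]
        · exact h.close n _ _ (length_seg _ _) (length_seg _ _) (by rw [hx, hy, hxy])
        · exact Finset.sum_nonneg fun k _ => by split_ifs <;> positivity
      · exact h.far n _ _ (length_seg _ _) (length_seg _ _) (by rwa [hx, hy])
    have h2 : (1 : ℝ) / 2 ^ (n + 1) = 1 / 2 ^ (n + 2) + 1 / 2 ^ (n + 2) := by
      rw [pow_succ _ (n + 1)]; field_simp; norm_num
    rw [h2] at ih
    rw [abs_le] at ih ⊢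
    rw [abs_lt] at hd
    constructor <;> linarith

theorem e2Dist_map_le (h : IsE2System m g) (x y : ℕ → Bool) (n : ℕ) :
    e2Dist (e2MapOf g x) (e2MapOf g y) (m n) ≤ e2Dist x y n + 1 / 2 := by
  have := (abs_le.1 (h.abs_e2Dist_sub_le x y n)).2
  have : (0 : ℝ) < 1 / 2 ^ (n + 1) := by positivity
  linarith

theorem le_e2Dist_map (h : IsE2System m g) (x y : ℕ → Bool) (n : ℕ) :
    e2Dist x y n - 1 / 2 ≤ e2Dist (e2MapOf g x) (e2MapOf g y) (m n) := by
  have := (abs_le.1 (h.abs_e2Dist_sub_le x y n)).1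
  have : (0 : ℝ) < 1 / 2 ^ (n + 1) := by positivity
  linarith

theorem not_E2_map (h : IsE2System m g) {x y : ℕ → Bool} (hxy : ¬E2 x y) :
    ¬E2 (e2MapOf g x) (e2MapOf g y) := by
  refine not_E2_of_unbounded fun M => ?_
  obtain ⟨n, hn⟩ := exists_lt_e2Dist hxy (M + 1)
  exact ⟨m n, by linarith [h.le_e2Dist_map x y n]⟩

theorem exists_block (h : IsE2System m g) (n : ℕ) : ∃ k, m k ≤ n ∧ n < m (k + 1) := by
  have hex : ∃ k, n < m (k + 1) := ⟨n, (Nat.lt_succ_self n).trans_le h.mono.le_apply⟩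
  classical
  have hspec := Nat.find_spec hex
  have hmin := @Nat.find_min _ _ hex
  generalize Nat.find hex = k at hspec hmin
  refine ⟨k, ?_, hspec⟩
  rcases k with _ | k
  · rw [h.zero]; exact Nat.zero_le n
  · exact not_lt.1 (hmin (Nat.lt_succ_self k))

end IsE2System

/-! ### Prescribing the decoded sequence in the range of an `E₂`-tree map -/

/-- The harmonic sums. -/
noncomputable def harmonicSum (n : ℕ) : ℝ := ∑ k ∈ Finset.range n, 1 / ((k : ℝ) + 1)

theorem harmonicSum_succ (n : ℕ) : harmonicSum (n + 1) = harmonicSum n + 1 / ((n : ℝ) + 1) :=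
  Finset.sum_range_succ _ _

theorem one_div_succ_le_one (n : ℕ) : 1 / ((n : ℝ) + 1) ≤ 1 :=
  div_le_one_of_le₀ (by linarith [(Nat.cast_nonneg n : (0 : ℝ) ≤ n)]) (by positivity)

theorem harmonicSum_mono : Monotone harmonicSum := monotone_nat_of_le_succ fun n => by
  rw [harmonicSum_succ]
  have : (0 : ℝ) ≤ 1 / ((n : ℝ) + 1) := by positivity
  linarith

theorem harmonicSum_nonneg (n : ℕ) : 0 ≤ harmonicSum n :=
  Finset.sum_nonneg fun k _ => by positivity

theorem e2Dist_succ_le (x y : ℕ → Bool) (n : ℕ) : e2Dist x y (n + 1) ≤ e2Dist x y n + 1 := by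
  rw [e2Dist_succ]
  have := one_div_succ_le_one n
  split_ifs <;> linarith

theorem e2Dist_le_harmonicSum (x y : ℕ → Bool) (n : ℕ) : e2Dist x y n ≤ harmonicSum n :=
  Finset.sum_le_sum fun k _ => by
    split_ifs
    · positivity
    · rfl

theorem exists_harmonicSum_mem {c : ℝ} (hc : 0 < c) :
    ∃ k, c ≤ harmonicSum k ∧ harmonicSum k ≤ c + 1 := by
  have hex : ∃ k, c ≤ harmonicSum k := (tendsto_harmonic_sum.eventually_ge_atTop c).exists
  classical
  have hspec := Nat.find_spec hex
  have hmin := @Nat.find_min _ _ hex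
  generalize Nat.find hex = k at hspec hmin
  refine ⟨k, hspec, ?_⟩
  rcases k with _ | k
  · simp only [harmonicSum, Finset.range_zero, Finset.sum_empty]; linarith
  · have h1 := hmin (Nat.lt_succ_self k)
    rw [harmonicSum_succ]
    linarith [one_div_succ_le_one k]

/-- If `x` and `y` agree once the harmonic sums exceed `c`, then they are close. -/
theorem e2Dist_le_of_agree {x y : ℕ → Bool} {c : ℝ} (hc : 0 ≤ c) {n : ℕ}
    (h : ∀ k < n, c ≤ harmonicSum k → x k = y k) : e2Dist x y n ≤ c + 1 := by
  induction n with
  | zero => rw [e2Dist_zero]; linarith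
  | succ n ih =>
    rcases le_or_gt c (harmonicSum n) with hn | hn
    · rw [e2Dist_succ, if_pos (h n (Nat.lt_succ_self n) hn), add_zero]
      exact ih fun k hk => h k (by omega)
    · linarith [e2Dist_succ_le x y n, e2Dist_le_harmonicSum x y n]

/-- Odd stages carry the bits of `b`, even stages compensate them. -/
def stageBit (b : ℕ → Bool) (i : ℕ) : Bool := if i % 2 = 1 then b (i / 2) else !b (i / 2 - 1)

theorem stageBit_odd (b : ℕ → Bool) (j : ℕ) : stageBit b (2 * j + 1) = b j := by
  rw [stageBit, if_pos (by omega)]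
  congr 1
  omega

theorem stageBit_even (b : ℕ → Bool) (j : ℕ) : stageBit b (2 * j + 2) = !b j := by
  rw [stageBit, if_neg (by omega)]
  congr 2
  omega

theorem exists_stageBit_eq (b : ℕ → Bool) (M : ℕ) (c : Bool) : ∃ i > M, stageBit b i = c := by
  by_cases h : b M = c
  · exact ⟨2 * M + 1, by omega, by rw [stageBit_odd, h]⟩
  · refine ⟨2 * M + 2, by omega, ?_⟩
    rw [stageBit_even]
    cases c <;> simp_all

/-- The sequence that is equal to `stageBit b i` while the harmonic sums are in
`[8 ^ i, 8 ^ (i + 1))`. -/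
noncomputable def stageSeq (b : ℕ → Bool) (k : ℕ) : Bool :=
  stageBit b (Nat.log 8 ⌊harmonicSum k⌋₊)

theorem stageSeq_eq (b : ℕ → Bool) {i k : ℕ} (h1 : 8 ^ i ≤ harmonicSum k)
    (h2 : harmonicSum k < 8 ^ (i + 1)) : stageSeq b k = stageBit b i := by
  rw [stageSeq, Nat.log_eq_of_pow_le_of_lt_pow (Nat.le_floor (by exact_mod_cast h1))
    ((Nat.floor_lt (harmonicSum_nonneg k)).2 (by exact_mod_cast h2))]

theorem e2Dist_stageSeq_const_le (b : ℕ → Bool) {i k : ℕ} (h : harmonicSum k < 8 ^ (i + 1)) :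
    e2Dist (stageSeq b) (fun _ => stageBit b i) k ≤ 8 ^ i + 1 :=
  e2Dist_le_of_agree (by positivity) fun k' hk' hc =>
    stageSeq_eq b hc ((harmonicSum_mono hk'.le).trans_lt h)

theorem e2Dist_not_left (x y : ℕ → Bool) (n : ℕ) :
    e2Dist (fun k => !x k) y n + e2Dist x y n = harmonicSum n := by
  rw [e2Dist, e2Dist, harmonicSum, ← Finset.sum_add_distrib]
  refine Finset.sum_congr rfl fun k _ => ?_
  cases x k <;> cases y k <;> simp

theorem e2Dist_not_not (x y : ℕ → Bool) (n : ℕ) :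
    e2Dist (fun k => !x k) (fun k => !y k) n = e2Dist x y n := by
  simp [e2Dist]

theorem not_E2_stageSeq_const (b : ℕ → Bool) (c : Bool) : ¬E2 (stageSeq b) fun _ => c := by
  refine not_E2_of_unbounded fun M => ?_
  obtain ⟨i, hi, hc⟩ := exists_stageBit_eq b M (!c)
  obtain ⟨k, hk1, hk2⟩ := exists_harmonicSum_mem (c := 6 * 8 ^ i) (by positivity)
  have h8 : (M : ℝ) + 1 ≤ 8 ^ i := by
    have h : i ≤ 8 ^ i := (Nat.lt_pow_self (by norm_num : 1 < 8)).le
    exact_mod_cast hi.trans_le h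
  have hM : (0 : ℝ) ≤ M := Nat.cast_nonneg M
  have h1 := e2Dist_stageSeq_const_le b (i := i) (k := k) (by rw [pow_succ]; linarith)
  have h2 := e2Dist_not_left (stageSeq b) (fun _ => !c) k
  rw [hc] at h1
  have h3 := e2Dist_not_not (stageSeq b) (fun _ => c) k
  exact ⟨k, by linarith⟩

theorem IsE2System.exists_triple_decodeCrossings_eq {m : ℕ → ℕ} {g : List Bool → List Bool}
    (h : IsE2System m g) (b : ℕ → Bool) :
    ∃ t ∈ triplesE2 (range (e2MapOf g)), decodeCrossings t = b := by
  let w := stageSeq b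
  let t := (e2MapOf g fun k => !w k, e2MapOf g w, e2MapOf g fun _ => false)
  have h01 : ¬E2 t.1 t.2.1 := h.not_E2_map (not_E2_of_eventually_ne (k := 0) fun j _ => by simp)
  have h12 : ¬E2 t.2.1 t.2.2 := h.not_E2_map (not_E2_stageSeq_const b false)
  have h02 : ¬E2 t.1 t.2.2 := h.not_E2_map fun hE => not_E2_stageSeq_const b true
    (hE.congr fun k => by cases hw : w k <;> simp_all [w])
  refine ⟨t, ⟨mem_range_self _, mem_range_self _, mem_range_self _, h01, h02, h12⟩, ?_⟩
  funext j
  obtain ⟨n, hn1, hn2⟩ := exists_crossing h01 j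
  rw [Bool.eq_iff_iff, decodeCrossings_eq_true_iff hn1 hn2]
  obtain ⟨k, hk1, hk2⟩ := h.exists_block n
  have e0 : ∀ n, oppDist (tripleFam t) 0 n = e2Dist (e2MapOf g w) (e2MapOf g fun _ => false) n :=
    fun n => rfl
  have e1 : ∀ n, oppDist (tripleFam t) 1 n =
      e2Dist (e2MapOf g fun k => !w k) (e2MapOf g fun _ => false) n := fun n => e2Dist_comm _ _ _
  have e2 : ∀ n, oppDist (tripleFam t) 2 n = e2Dist (e2MapOf g fun k => !w k) (e2MapOf g w) n :=
    fun n => rfl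
  have hH : ∀ n, e2Dist (fun k => !w k) w n = harmonicSum n := fun n => by
    simpa [e2Dist_self] using e2Dist_not_left w w n
  have hlow : harmonicSum k < threshold j + 1 / 2 := by
    have := h.le_e2Dist_map (fun k => !w k) w k
    have := oppDist_mono (tripleFam t) 2 hk1
    rw [e2] at this
    linarith [hH k]
  have hup : threshold j ≤ harmonicSum k + 3 / 2 := by
    have := h.e2Dist_map_le (fun k => !w k) w (k + 1)
    have := oppDist_mono (tripleFam t) 2 (Nat.succ_le_of_lt hk2)
    rw [e2 (m _)] at this
    have := e2Dist_succ_le (fun k => !w k) w k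
    linarith [hH k]
  have h8 : (8 : ℝ) ≤ 8 ^ (2 * j + 1) := le_self_pow₀ (by norm_num) (by omega)
  rw [threshold] at hlow hup
  have hstage := e2Dist_stageSeq_const_le b (i := 2 * j + 1) (k := k)
    (by rw [pow_succ _ (2 * j + 1)]; linarith)
  rw [stageBit_odd] at hstage
  have hsum := e2Dist_not_left w (fun _ => false) k
  have hm0 := oppDist_mono (tripleFam t) 0 hk1
  have hm0' := oppDist_mono (tripleFam t) 0 hk2.le
  have hm1 := oppDist_mono (tripleFam t) 1 hk1
  have hm1' := oppDist_mono (tripleFam t) 1 hk2.le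
  rw [e0 (m _)] at hm0 hm0'
  rw [e1 (m _)] at hm1 hm1'
  have l0 := h.le_e2Dist_map w (fun _ => false) k
  have u0 := h.e2Dist_map_le w (fun _ => false) (k + 1)
  have l1 := h.le_e2Dist_map (fun k => !w k) (fun _ => false) k
  have u1 := h.e2Dist_map_le (fun k => !w k) (fun _ => false) (k + 1)
  have s0 := e2Dist_succ_le w (fun _ => false) k
  have s1 := e2Dist_succ_le (fun k => !w k) (fun _ => false) k
  cases hb : b j
  · rw [hb] at hstage
    refine iff_of_false (fun hle => ?_) (by simp)
    linarith
  · rw [hb] at hstage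
    have := e2Dist_not_not w (fun _ => true) k
    refine iff_of_true ?_ rfl
    simp only [Bool.not_true] at this
    linarith

/-- There is a continuous `Q : [2^ω]³_{E₂} → 2^ω` with `Q[[range Φ]³_{E₂}] = 2^ω` for every
`E₂`-tree map `Φ`, and a Borel `K : (2^ω)³ → 2^ω` with `K[[A]³_{E₂}] = 2^ω` for every
analytic `A` into which `E₂` Borel-reduces. -/
theorem exists_Q_and_K_for_E2 :
    (∃ Q : (ℕ → Bool) × (ℕ → Bool) × (ℕ → Bool) → (ℕ → Bool),
      ContinuousOn Q (triplesE2 univ) ∧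
      ∀ Φ : (ℕ → Bool) → (ℕ → Bool), IsE2TreeMap Φ →
        Q '' triplesE2 (range Φ) = univ) ∧
    (∃ K : (ℕ → Bool) × (ℕ → Bool) × (ℕ → Bool) → (ℕ → Bool), Measurable K ∧
      ∀ A : Set (ℕ → Bool), MeasureTheory.AnalyticSet A →
        (∃ f : (ℕ → Bool) → (ℕ → Bool),
          Measurable f ∧ range f ⊆ A ∧ ∀ x y, E2 x y ↔ E2 (f x) (f y)) →
        K '' triplesE2 A = univ) := by
  refine ⟨⟨decodeCrossings, continuousOn_decodeCrossings, ?_⟩,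
    decodeLeaders, measurable_decodeLeaders, ?_⟩
  · rintro _ ⟨m, g, h, rfl⟩
    exact eq_univ_of_forall fun b => h.exists_triple_decodeCrossings_eq b
  · rintro A - ⟨f, hf, hfA, hom⟩
    refine eq_univ_of_forall fun b => ?_
    obtain ⟨t, ⟨h0, h1, h2, ht⟩, hb⟩ := exists_triple_decodeLeaders_eq hf hom b
    exact ⟨t, ⟨hfA h0, hfA h1, hfA h2, ht⟩, hb⟩
end

section
/- Let D = {(x,y) ∈ ((2^ω)^ω)² : x(0) ≠ y(0)}. Then D is a dense open subset of (2^ω)^ω × (2^ω)^ω, and for every analytic set B ⊆ (2^ω)^ω admitting a Borel reduction of E_3 into E_3 ↾ B, [B]²_{E_3} is not contained in D. Hence E_3 does not have the 2-Mycielski property. -/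
open Set Function

/-- The eventual-agreement equivalence relation `E₀` on `2^ω`. -/
def E0 (x y : ℕ → Bool) : Prop := ∃ n, ∀ k > n, x k = y k

/-- The equivalence relation `E₃` on `(2^ω)^ω`: coordinatewise `E₀`. -/
def E3 (x y : ℕ → (ℕ → Bool)) : Prop := ∀ n, E0 (x n) (y n)

/-- The dense open set witnessing the failure of the 2-Mycielski property for `E₃`. -/
def D17 : Set ((ℕ → (ℕ → Bool)) × (ℕ → (ℕ → Bool))) :=
  {p | p.1 0 ≠ p.2 0}

open Filter Topology

namespace E3Baire

/-- A sequence of finite modifications of points of `2^ω`, each coded by a natural number, acting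
coordinatewise on `(2^ω)^ω`. -/
def act (c : ℕ → ℕ) (x : ℕ → ℕ → Bool) : ℕ → ℕ → Bool :=
  fun i j => xor (x i j) ((c i).testBit j)

/-- Negation of all bits of all coordinates with index at least `n`. -/
def flipFrom (n : ℕ) (x : ℕ → ℕ → Bool) : ℕ → ℕ → Bool :=
  fun i j => xor (x i j) (decide (n ≤ i))

/-- The sequence of modifications flipping the first `N` bits of each coordinate from `n` on. -/
def patch (n N : ℕ) : ℕ → ℕ := fun i => if n ≤ i then 2 ^ N - 1 else 0

/-- Basic neighbourhoods in the product of `(2^ω)^ω` with the space of modifications. -/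
def box (w : (ℕ → ℕ → Bool) × (ℕ → ℕ)) (n : ℕ) : Set ((ℕ → ℕ → Bool) × (ℕ → ℕ)) :=
  {v | ∀ i < n, (∀ j < n, v.1 i j = w.1 i j) ∧ v.2 i = w.2 i}

theorem isOpen_box (w : (ℕ → ℕ → Bool) × (ℕ → ℕ)) (n : ℕ) : IsOpen (box w n) := by
  have h : box w n = ⋂ i ∈ Set.Iio n, ((⋂ j ∈ Set.Iio n, {v | v.1 i j = w.1 i j}) ∩
      {v | v.2 i = w.2 i}) := by
    ext v
    simp [box]
  rw [h]
  refine (Set.finite_Iio n).isOpen_biInter fun i _ => IsOpen.inter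
    ((Set.finite_Iio n).isOpen_biInter fun j _ => ?_) ?_
  · exact (isOpen_discrete {w.1 i j}).preimage (by fun_prop)
  · exact (isOpen_discrete {w.2 i}).preimage (by fun_prop)

theorem mem_box_self (w : (ℕ → ℕ → Bool) × (ℕ → ℕ)) (n : ℕ) : w ∈ box w n :=
  fun _ _ => ⟨fun _ _ => rfl, rfl⟩

theorem exists_box_subset {O : Set ((ℕ → ℕ → Bool) × (ℕ → ℕ))} (hO : IsOpen O)
    {w : (ℕ → ℕ → Bool) × (ℕ → ℕ)} (hw : w ∈ O) (m : ℕ) : ∃ n ≥ m, box w n ⊆ O := by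
  by_contra! h
  have h' : ∀ n, ∃ v, v ∈ box w (n + m) ∧ v ∉ O := fun n =>
    Set.not_subset.1 (h (n + m) (by omega))
  choose v hv hvO using h'
  have hlim : Tendsto v atTop (𝓝 w) := by
    refine Tendsto.prodMk_nhds (x := w.1) (y := w.2) (mx := fun n => (v n).1)
      (my := fun n => (v n).2) ?_ ?_
    · refine tendsto_pi_nhds.2 fun i => tendsto_pi_nhds.2 fun j => ?_
      refine tendsto_const_nhds.congr' ?_
      filter_upwards [eventually_gt_atTop (i + j)] with n hn
      exact ((hv n i (by omega)).1 j (by omega)).symm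
    · refine tendsto_pi_nhds.2 fun i => tendsto_const_nhds.congr' ?_
      filter_upwards [eventually_gt_atTop i] with n hn
      exact (hv n i (by omega)).2.symm
  obtain ⟨n, hn⟩ := (hlim.eventually (hO.mem_nhds hw)).exists
  exact hvO n hn

/-- If countably many Borel sets cover a nonempty open set, one of them is comeagre in some
nonempty open subset. -/
theorem exists_isOpen_eventually_mem {W ι : Type*} [TopologicalSpace W] [BaireSpace W]
    [MeasurableSpace W] [BorelSpace W] [Countable ι] {A : ι → Set W}
    (hA : ∀ i, MeasurableSet (A i)) {O : Set W} (hO : IsOpen O) (hne : O.Nonempty)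
    (hcov : ∀ w ∈ O, ∃ i, w ∈ A i) :
    ∃ i, ∃ O' ⊆ O, IsOpen O' ∧ O'.Nonempty ∧ ∀ᶠ w in residual W, w ∈ O' → w ∈ A i := by
  choose U hU hAU using fun i => (hA i).residualEq_isOpen
  have hev : ∀ᶠ w in residual W, ∀ i, w ∈ A i ↔ w ∈ U i :=
    eventually_countable_forall.2 fun i => eventuallyEq_set.1 (hAU i)
  obtain ⟨w, hwO, hw⟩ := (dense_of_mem_residual hev).inter_open_nonempty O hO hne
  obtain ⟨i, hi⟩ := hcov w hwO
  refine ⟨i, O ∩ U i, Set.inter_subset_left, hO.inter (hU i), ⟨w, hwO, (hw i).1 hi⟩, ?_⟩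
  filter_upwards [hev] with v hv hvO
  exact (hv i).2 hvO.2

theorem continuous_act : Continuous fun w : (ℕ → ℕ → Bool) × (ℕ → ℕ) => act w.2 w.1 := by
  refine continuous_pi fun i => continuous_pi fun j => ?_
  have h : Continuous fun p : Bool × ℕ => xor p.1 (p.2.testBit j) := continuous_of_discreteTopology
  exact h.comp (f := fun w : (ℕ → ℕ → Bool) × (ℕ → ℕ) => (w.1 i j, w.2 i)) (by fun_prop)

theorem continuous_flipFrom (n : ℕ) : Continuous (flipFrom n) := by
  refine continuous_pi fun i => continuous_pi fun j => ?_
  have h : Continuous fun b : Bool => xor b (decide (n ≤ i)) := continuous_of_discreteTopology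
  exact h.comp (f := fun x : ℕ → ℕ → Bool => x i j) (by fun_prop)

theorem act_act_self (c : ℕ → ℕ) (x : ℕ → ℕ → Bool) : act c (act c x) = x := by
  funext i j
  simp [act]

theorem flipFrom_flipFrom (n : ℕ) (x : ℕ → ℕ → Bool) : flipFrom n (flipFrom n x) = x := by
  funext i j
  simp [flipFrom]

theorem act_flipFrom (c : ℕ → ℕ) (n : ℕ) (x : ℕ → ℕ → Bool) :
    act c (flipFrom n x) = flipFrom n (act c x) := by
  funext i j
  exact Bool.xor_right_comm _ _ _

theorem act_xor_act (c d : ℕ → ℕ) (x : ℕ → ℕ → Bool) :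
    act (fun i => c i ^^^ d i) (act d x) = act c x := by
  funext i j
  simp only [act, Nat.testBit_xor]
  cases x i j <;> cases (c i).testBit j <;> cases (d i).testBit j <;> rfl

theorem e3_act (c : ℕ → ℕ) (x : ℕ → ℕ → Bool) : E3 x (act c x) := by
  refine fun i => ⟨c i, fun k hk => ?_⟩
  have h : (c i).testBit k = false :=
    Nat.testBit_eq_false_of_lt (hk.trans Nat.lt_two_pow_self)
  simp [act, h]

theorem not_e3_flipFrom (n : ℕ) (x : ℕ → ℕ → Bool) : ¬E3 x (flipFrom n x) := by
  intro h
  obtain ⟨m, hm⟩ := h n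
  simpa [flipFrom] using hm (m + 1) (by omega)

theorem _root_.E0.exists_testBit {u v : ℕ → Bool} (h : E0 u v) :
    ∃ e : ℕ, ∀ k, v k = xor (u k) (e.testBit k) := by
  obtain ⟨n, hn⟩ := h
  refine ⟨Nat.ofBits fun k : Fin (n + 1) => xor (u k) (v k), fun k => ?_⟩
  rcases Nat.lt_or_ge k (n + 1) with hk | hk
  · rw [Nat.testBit_ofBits_lt _ _ hk]
    simp
  · rw [Nat.testBit_ofBits_ge _ _ hk]
    simp [hn k hk]

/-- The change of variables `(x, c) ↦ (d x, c + d)`, as a homeomorphism. -/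
def shift (d : ℕ → ℕ) : ((ℕ → ℕ → Bool) × (ℕ → ℕ)) ≃ₜ ((ℕ → ℕ → Bool) × (ℕ → ℕ)) :=
  have hc : Continuous fun w : (ℕ → ℕ → Bool) × (ℕ → ℕ) =>
      (act d w.1, fun i => w.2 i ^^^ d i) := by
    refine Continuous.prodMk (continuous_act.comp (by fun_prop : Continuous fun w :
      (ℕ → ℕ → Bool) × (ℕ → ℕ) => (w.1, d))) (continuous_pi fun i => ?_)
    have h : Continuous fun a : ℕ => a ^^^ d i := continuous_of_discreteTopology
    exact h.comp (f := fun w : (ℕ → ℕ → Bool) × (ℕ → ℕ) => w.2 i) (by fun_prop)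
  have hi : Function.Involutive fun w : (ℕ → ℕ → Bool) × (ℕ → ℕ) =>
      (act d w.1, fun i => w.2 i ^^^ d i) := fun w => by
    simp [act_act_self]
  { hi.toPerm _ with
    continuous_toFun := hc
    continuous_invFun := hc }

/-- The change of variables `(x, c) ↦ (d x with all bits from coordinate n on negated, c)`. -/
def flipShift (d : ℕ → ℕ) (n : ℕ) :
    ((ℕ → ℕ → Bool) × (ℕ → ℕ)) ≃ₜ ((ℕ → ℕ → Bool) × (ℕ → ℕ)) :=
  have hc : Continuous fun w : (ℕ → ℕ → Bool) × (ℕ → ℕ) => (flipFrom n (act d w.1), w.2) :=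
    ((continuous_flipFrom n).comp (continuous_act.comp (by fun_prop : Continuous fun w :
      (ℕ → ℕ → Bool) × (ℕ → ℕ) => (w.1, d)))).prodMk continuous_snd
  have hi : Function.Involutive fun w : (ℕ → ℕ → Bool) × (ℕ → ℕ) =>
      (flipFrom n (act d w.1), w.2) := fun w => by
    simp [act_flipFrom, act_act_self, flipFrom_flipFrom]
  { hi.toPerm _ with
    continuous_toFun := hc
    continuous_invFun := hc }

theorem _root_.Homeomorph.eventually_residual {X Y : Type*} [TopologicalSpace X]
    [TopologicalSpace Y] (h : X ≃ₜ Y) {p : Y → Prop} (hp : ∀ᶠ y in residual Y, p y) :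
    ∀ᶠ x in residual X, p (h x) :=
  (tendsto_residual_of_isOpenMap h.continuous h.isOpenMap).eventually hp

theorem shift_mem_box {w v : (ℕ → ℕ → Bool) × (ℕ → ℕ)} {n : ℕ} (N : ℕ) (hv : v ∈ box w n) :
    shift (patch n N) v ∈ box w n := by
  intro i hi
  have h : patch n N i = 0 := if_neg (by omega)
  change (∀ j < n, act (patch n N) v.1 i j = w.1 i j) ∧ v.2 i ^^^ patch n N i = w.2 i
  simpa [act, h] using hv i hi

theorem flipShift_mem_box {w v : (ℕ → ℕ → Bool) × (ℕ → ℕ)} {n N : ℕ} (hv : v ∈ box w N) :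
    flipShift (patch n N) n v ∈ box w N := by
  refine fun i hi => ⟨fun j hj => ?_, (hv i hi).2⟩
  change flipFrom n (act (patch n N) v.1) i j = w.1 i j
  rw [← (hv i hi).1 j hj]
  by_cases h : n ≤ i <;> simp [flipFrom, act, patch, h, hj]

/-- There is no Borel map sending `E₃`-equivalent points to `E₀`-equivalent points and
inequivalent points to distinct points. -/
theorem not_exists_measurable_e0 {g : (ℕ → ℕ → Bool) → ℕ → Bool} (hg : Measurable g)
    (hE : ∀ x y, E3 x y → E0 (g x) (g y)) : ∃ x y, g x = g y ∧ ¬E3 x y := by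
  by_contra! hinj
  have hbit : ∀ k, Measurable fun x => g x k := fun k => (measurable_pi_apply k).comp hg
  have hact : Measurable fun w : (ℕ → ℕ → Bool) × (ℕ → ℕ) => act w.2 w.1 :=
    continuous_act.measurable
  obtain ⟨e, O, -, hO, ⟨w, hw⟩, he⟩ := exists_isOpen_eventually_mem
    (W := (ℕ → ℕ → Bool) × (ℕ → ℕ))
    (A := fun e : ℕ => {v | ∀ k, g (act v.2 v.1) k = xor (g v.1 k) (e.testBit k)})
    (fun e => by
      simp only [Set.ofPred_forall]
      refine MeasurableSet.iInter fun k => measurableSet_eq_fun ((hbit k).comp hact) ?_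
      exact (measurable_of_countable fun b => xor b (e.testBit k)).comp
        ((hbit k).comp measurable_fst))
    isOpen_univ Set.univ_nonempty (fun v _ => (hE _ _ (e3_act v.2 v.1)).exists_testBit)
  obtain ⟨n, -, hn⟩ := exists_box_subset hO hw 0
  obtain ⟨⟨k, b⟩, O', hO'n, hO', ⟨w', hw'⟩, hkb⟩ := exists_isOpen_eventually_mem
    (W := (ℕ → ℕ → Bool) × (ℕ → ℕ))
    (A := fun q : ℕ × Bool => {v | g v.1 q.1 = q.2 ∧ g (flipFrom n v.1) q.1 = !q.2})
    (fun q => ((measurableSet_singleton q.2).preimage ((hbit q.1).comp measurable_fst)).inter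
      ((measurableSet_singleton (!q.2)).preimage
        ((hbit q.1).comp ((continuous_flipFrom n).measurable.comp measurable_fst))))
    (isOpen_box w n) ⟨w, mem_box_self w n⟩ (fun v _ => by
      by_contra! h
      refine not_e3_flipFrom n v.1 (hinj _ _ (funext fun k => ?_))
      have := h (k, g v.1 k)
      simp at this
      exact this.symm)
  obtain ⟨N, -, hN⟩ := exists_box_subset hO' hw' n
  have hev := (he.and ((shift (patch n N)).eventually_residual he)).and
    (hkb.and ((flipShift (patch n N) n).eventually_residual hkb))
  obtain ⟨v, hv, ⟨h1, h2⟩, h3, h4⟩ := (dense_of_mem_residual hev).inter_open_nonempty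
    (box w' N) (isOpen_box w' N) ⟨w', mem_box_self w' N⟩
  have hvn := hO'n (hN hv)
  have e1 := h1 (hn hvn) k
  have e2 : g (act (fun i => v.2 i ^^^ patch n N i) (act (patch n N) v.1)) k =
      xor (g (act (patch n N) v.1) k) (e.testBit k) := h2 (hn (shift_mem_box N hvn)) k
  have e3 : g v.1 k = b := (h3 (hN hv)).1
  have e4 : g (flipFrom n (flipFrom n (act (patch n N) v.1))) k = !b :=
    (h4 (hN (flipShift_mem_box hv))).2
  rw [flipFrom_flipFrom] at e4
  rw [act_xor_act, e1, e3, e4] at e2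
  cases b <;> simp at e2

theorem isOpen_D17 : IsOpen D17 :=
  isOpen_ne_fun (by fun_prop) (by fun_prop)

theorem dense_D17 : Dense D17 := by
  rw [dense_iff_closure_eq, Set.eq_univ_iff_forall]
  intro p
  by_cases hp : p.1 0 = p.2 0
  · let q : ℕ → (ℕ → ℕ → Bool) × (ℕ → ℕ → Bool) := fun n =>
      (p.1, fun i j => xor (p.2 i j) (decide (n ≤ j)))
    have hq : Tendsto q atTop (𝓝 p) := by
      refine Tendsto.prodMk_nhds (x := p.1) (y := p.2) tendsto_const_nhds ?_
      refine tendsto_pi_nhds.2 fun i => tendsto_pi_nhds.2 fun j => tendsto_const_nhds.congr' ?_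
      filter_upwards [eventually_gt_atTop j] with n hn
      simp [Nat.not_le.2 hn]
    refine mem_closure_of_tendsto hq (Eventually.of_forall fun n h => ?_)
    have hne : p.2 0 n = xor (p.2 0 n) (decide (n ≤ n)) := congrFun (hp.symm.trans h) n
    simp at hne
  · exact subset_closure hp

end E3Baire

/-- `E₃` does not have the 2-Mycielski property: `D17` is dense open, yet for every analytic
`B ⊆ (2^ω)^ω` into which `E₃` Borel-reduces (within `B`), `[B]²_{E₃} ⊄ D17`. -/
theorem e3_not_two_mycielski :
    (IsOpen D17 ∧ Dense D17) ∧
    ∀ B : Set (ℕ → (ℕ → Bool)), MeasureTheory.AnalyticSet B →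
      (∃ f : (ℕ → (ℕ → Bool)) → (ℕ → (ℕ → Bool)),
        Measurable f ∧ range f ⊆ B ∧ ∀ x y, E3 x y ↔ E3 (f x) (f y)) →
      ¬{p : (ℕ → (ℕ → Bool)) × (ℕ → (ℕ → Bool)) |
          p.1 ∈ B ∧ p.2 ∈ B ∧ ¬E3 p.1 p.2} ⊆ D17 := by
  refine ⟨⟨E3Baire.isOpen_D17, E3Baire.dense_D17⟩, ?_⟩
  rintro B - ⟨f, hf, hfB, hred⟩ hsub
  obtain ⟨x, y, hxy, hne⟩ := E3Baire.not_exists_measurable_e0 (g := fun x => f x 0)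
    ((measurable_pi_apply 0).comp hf) (fun x y h => (hred x y).1 h 0)
  exact hsub (a := (f x, f y))
    ⟨hfB ⟨x, rfl⟩, hfB ⟨y, rfl⟩, fun h => hne ((hred x y).2 h)⟩ hxy
end
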